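/- For all reals D > 0, x₀ > 0, and σ ≥ 0, the positive-drift first-passage density integrates over time to the hitting probability: ∫₀^∞ (x₀/√(4πDt³))·exp(−(x₀ + σt)²/(4Dt)) dt = exp(−σx₀/D). -/

import Mathlib

open MeasureTheory

open Filter Topology in
theorem tendsto_integral_exp_neg_sq_atTop :
    Tendsto (fun y : ℝ => ∫ s in (0 : ℝ)..y, Real.exp (-s ^ 2)) atTop
      (𝓝 (√Real.pi / 2)) := by
  have hint : Integrable (fun s : ℝ => Real.exp (-s ^ 2)) := by
    simpa using integrable_exp_neg_mul_sq (b := 1) one_pos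
  have hval : ∫ s in Set.Ioi (0 : ℝ), Real.exp (-s ^ 2) = √Real.pi / 2 := by
    simpa using integral_gaussian_Ioi 1
  rw [← hval]
  exact intervalIntegral_tendsto_integral_Ioi 0 hint.integrableOn tendsto_id

open Filter Topology in
theorem tendsto_integral_exp_neg_sq_atBot :
    Tendsto (fun y : ℝ => ∫ s in (0 : ℝ)..y, Real.exp (-s ^ 2)) atBot
      (𝓝 (-(√Real.pi / 2))) := by
  refine (tendsto_integral_exp_neg_sq_atTop.comp tendsto_neg_atBot_atTop).neg.congr fun y => ?_
  have h := intervalIntegral.integral_comp_neg (a := y) (b := 0)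
    (fun s : ℝ => Real.exp (-s ^ 2))
  simp only [neg_sq, neg_zero] at h
  rw [Function.comp_apply, ← h, intervalIntegral.integral_symm, neg_neg]

theorem hasDerivAt_integral_exp_neg_sq (y : ℝ) :
    HasDerivAt (fun y : ℝ => ∫ s in (0 : ℝ)..y, Real.exp (-s ^ 2)) (Real.exp (-y ^ 2)) y :=
  (Continuous.integral_hasStrictDerivAt (by fun_prop) 0 y).hasDerivAt

theorem hasDerivAt_mul_sqrt_sub_div_sqrt (a b : ℝ) {t : ℝ} (ht : 0 < t) :
    HasDerivAt (fun t : ℝ => b * √t - a / √t) (a / (2 * √t ^ 3) + b / (2 * √t)) t := by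
  have hu : √t ≠ 0 := (Real.sqrt_pos.2 ht).ne'
  have h := (Real.hasDerivAt_sqrt ht.ne')
  refine ((h.const_mul b).sub ((hasDerivAt_const t a).div h hu)).congr_deriv ?_
  field_simp
  ring

open Filter Topology in
theorem tendsto_mul_sqrt_sub_div_sqrt_nhdsGT {a : ℝ} (ha : 0 < a) (b : ℝ) :
    Tendsto (fun t : ℝ => b * √t - a / √t) (𝓝[>] 0) atBot := by
  have h0 : Tendsto (fun t : ℝ => √t) (𝓝[>] 0) (𝓝[>] 0) := by
    refine tendsto_nhdsWithin_iff.2 ⟨?_, ?_⟩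
    · simpa using (Real.continuous_sqrt.tendsto 0).mono_left nhdsWithin_le_nhds
    · filter_upwards [self_mem_nhdsWithin] with t ht using Real.sqrt_pos.2 ht
  have h1 : Tendsto (fun t : ℝ => -(a / √t)) (𝓝[>] 0) atBot :=
    tendsto_neg_atTop_atBot.comp ((tendsto_inv_nhdsGT_zero.comp h0).const_mul_atTop ha)
  have h2 : Tendsto (fun t : ℝ => b * √t) (𝓝[>] 0) (𝓝 (b * 0)) :=
    (h0.mono_right nhdsWithin_le_nhds).const_mul b
  simpa only [sub_eq_add_neg] using h2.add_atBot h1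

open Filter Topology in
theorem tendsto_div_sqrt_atTop (a : ℝ) : Tendsto (fun t : ℝ => a / √t) atTop (𝓝 0) :=
  tendsto_const_nhds.div_atTop Real.tendsto_sqrt_atTop

open Filter Topology in
theorem integral_div_sqrt_pow_three_mul_exp {a b : ℝ} (ha : 0 < a) (hb : 0 ≤ b) :
    ∫ t in Set.Ioi (0 : ℝ), a / √t ^ 3 * Real.exp (-(a / √t + b * √t) ^ 2) =
      √Real.pi * Real.exp (-(4 * a * b)) := by
  set E : ℝ → ℝ := fun y => ∫ s in (0 : ℝ)..y, Real.exp (-s ^ 2) with hE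
  set k := Real.exp (-(4 * a * b)) with hk
  set F : ℝ → ℝ := fun t => E (-b * √t - a / √t) + k * E (b * √t - a / √t) with hF
  have hderiv : ∀ t ∈ Set.Ioi (0 : ℝ),
      HasDerivAt F (a / √t ^ 3 * Real.exp (-(a / √t + b * √t) ^ 2)) t := by
    intro t ht
    have hu : √t ≠ 0 := (Real.sqrt_pos.2 ht).ne'
    have h1 := (hasDerivAt_integral_exp_neg_sq _).comp t
      (hasDerivAt_mul_sqrt_sub_div_sqrt a (-b) ht)
    have h2 := ((hasDerivAt_integral_exp_neg_sq _).comp t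
      (hasDerivAt_mul_sqrt_sub_div_sqrt a b ht)).const_mul k
    refine (h1.add h2).congr_deriv ?_
    have e1 : -(-b * √t - a / √t) ^ 2 = -(a / √t + b * √t) ^ 2 := by ring
    have e2 : k * Real.exp (-(b * √t - a / √t) ^ 2) =
        Real.exp (-(a / √t + b * √t) ^ 2) := by
      rw [hk, ← Real.exp_add]
      congr 1
      field_simp
      ring
    rw [← mul_assoc, e2, e1]
    field_simp
    ring
  have hzero : Tendsto F (𝓝[>] 0) (𝓝 (-(√Real.pi / 2) + k * -(√Real.pi / 2))) :=
    (tendsto_integral_exp_neg_sq_atBot.comp (tendsto_mul_sqrt_sub_div_sqrt_nhdsGT ha _)).add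
      ((tendsto_integral_exp_neg_sq_atBot.comp
        (tendsto_mul_sqrt_sub_div_sqrt_nhdsGT ha _)).const_mul k)
  have htop : Tendsto F atTop (𝓝 (-(√Real.pi / 2) + k * (√Real.pi / 2))) := by
    have hd := (tendsto_div_sqrt_atTop a).neg
    rcases hb.eq_or_lt with rfl | hb
    · have hcont : Continuous E :=
        continuous_iff_continuousAt.2 fun y => (hasDerivAt_integral_exp_neg_sq y).continuousAt
      have h := (hcont.tendsto _).comp hd
      have hE0 : E 0 = 0 := by simp [hE]
      have hk1 : k = 1 := by simp [hk]
      simpa [hF, hk1, hE0, Function.comp_def] using h.add h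
    · have hbot : Tendsto (fun t : ℝ => -b * √t - a / √t) atTop atBot := by
        simpa only [sub_eq_add_neg] using
          (Real.tendsto_sqrt_atTop.const_mul_atTop_of_neg (neg_lt_zero.2 hb)).atBot_add hd
      have htop : Tendsto (fun t : ℝ => b * √t - a / √t) atTop atTop := by
        simpa only [sub_eq_add_neg] using
          (Real.tendsto_sqrt_atTop.const_mul_atTop hb).atTop_add hd
      exact (tendsto_integral_exp_neg_sq_atBot.comp hbot).add
        ((tendsto_integral_exp_neg_sq_atTop.comp htop).const_mul k)
  set l := -(√Real.pi / 2) + k * -(√Real.pi / 2) with hl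
  have hcont : ContinuousWithinAt (Function.update F 0 l) (Set.Ici 0) 0 := by
    rw [continuousWithinAt_update_same, Set.Ici_sdiff_left]
    exact hzero
  have hderiv' : ∀ t ∈ Set.Ioi (0 : ℝ), HasDerivAt (Function.update F 0 l)
      (a / √t ^ 3 * Real.exp (-(a / √t + b * √t) ^ 2)) t := fun t ht =>
    (hderiv t ht).congr_of_eventuallyEq <| by
      filter_upwards [lt_mem_nhds ht] with s hs using Function.update_of_ne hs.ne' _ _
  have htop' : Tendsto (Function.update F 0 l) atTop
      (𝓝 (-(√Real.pi / 2) + k * (√Real.pi / 2))) :=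
    htop.congr' <| by
      filter_upwards [eventually_gt_atTop 0] with s hs using
        (Function.update_of_ne hs.ne' _ _).symm
  rw [integral_Ioi_of_hasDerivAt_of_nonneg hcont hderiv' (fun t _ => by positivity) htop',
    Function.update_self, hl]
  ring

/-- The positive-drift first-passage density integrates over time to the hitting
probability: `∫₀^∞ (x₀/√(4πDt³))·exp(−(x₀+σt)²/(4Dt)) dt = exp(−σx₀/D)`. -/
theorem integral_fplus_eq_hitting_prob (D x₀ σ : ℝ) (hD : 0 < D) (hx₀ : 0 < x₀)
    (hσ : 0 ≤ σ) :
    ∫ t in Set.Ioi (0 : ℝ),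
        x₀ / Real.sqrt (4 * Real.pi * D * t ^ 3) *
          Real.exp (-(x₀ + σ * t) ^ 2 / (4 * D * t)) =
      Real.exp (-σ * x₀ / D) := by
  have hc : 0 < √(4 * D) := Real.sqrt_pos.2 (by positivity)
  have hc2 : √(4 * D) ^ 2 = 4 * D := Real.sq_sqrt (by positivity)
  have hpi : 0 < √Real.pi := Real.sqrt_pos.2 Real.pi_pos
  have key := integral_div_sqrt_pow_three_mul_exp (div_pos hx₀ hc) (div_nonneg hσ hc.le)
  have hexp : -(4 * (x₀ / √(4 * D)) * (σ / √(4 * D))) = -σ * x₀ / D := by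
    field_simp
    rw [hc2]
  rw [hexp] at key
  rw [← mul_right_inj' hpi.ne', ← key, ← integral_const_mul]
  refine setIntegral_congr_fun measurableSet_Ioi fun t (ht : 0 < t) => ?_
  have hu : 0 < √t := Real.sqrt_pos.2 ht
  have hu2 : √t ^ 2 = t := Real.sq_sqrt ht.le
  have hsqrt : √(4 * Real.pi * D * t ^ 3) = √Real.pi * √(4 * D) * √t ^ 3 := by
    rw [Real.sqrt_eq_iff_mul_self_eq_of_pos (by positivity)]
    calc _ = √Real.pi ^ 2 * √(4 * D) ^ 2 * (√t ^ 2) ^ 3 := by ring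
      _ = _ := by rw [hc2, hu2, Real.sq_sqrt Real.pi_pos.le]; ring
  have harg : -(x₀ / √(4 * D) / √t + σ / √(4 * D) * √t) ^ 2 =
      -(x₀ + σ * t) ^ 2 / (4 * D * t) := by
    have hsum : x₀ / √(4 * D) / √t + σ / √(4 * D) * √t =
        (x₀ + σ * t) / (√(4 * D) * √t) := by
      field_simp
      rw [hu2]
      ring
    rw [hsum, div_pow, mul_pow, hc2, hu2, neg_div]
  simp only [harg, hsqrt]
  field_simp
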